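/- Let β, γ > 0, D ≥ 1, let (X,d,m) be a metric measure space, and fix x0 ∈ X. Assume: (i) there exists a constant C > 0, independent of k, such that for every k ∈ ℕ and every Lipschitz function u : X → ℝ with bounded support, (∫_X d(x0,x)^{2k} (lip u(x))² dm)(∫_X d(x0,x)^{2k+2} u(x)² dm) ≥ (C+k)² (∫_X d(x0,x)^{2k} u(x)² dm)²; (ii) the volume doubling condition: m(B_R(x))/R^γ ≤ D · m(B_r(x))/r^γ for all 0 < r < R and all x ∈ X; (iii) liminf_{r→0⁺} m(B_r(x0))/r^β = c* for some c* ∈ (0,∞). Then 2C ≤ β ≤ γ. -/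

import Mathlib

open MeasureTheory Filter Metric
open scoped ENNReal Topology NNReal

/-- The local Lipschitz constant `lip u (x) = limsup_{y → x} |u y - u x| / d(y,x)`. -/
noncomputable def lip {X : Type*} [MetricSpace X] (u : X → ℝ) (x : X) : ℝ :=
  Filter.limsup (fun y => |u y - u x| / dist y x) (𝓝[≠] x)

/-- Polynomial volume growth makes `x ↦ exp (-dist x0 x)` integrable. -/
theorem integrable_exp_neg_dist {X : Type*} [MetricSpace X] [MeasurableSpace X] [BorelSpace X]
    (m : Measure X) (x0 : X) (A γ : ℝ)
    (hfin : ∀ r, m (ball x0 r) < ⊤)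
    (hgrow : ∀ R : ℝ, 1 ≤ R → (m (ball x0 R)).toReal ≤ A * R ^ γ) :
    Integrable (fun x => Real.exp (-dist x0 x)) m := by
  have hcont : Continuous fun x : X => Real.exp (-dist x0 x) := by fun_prop
  obtain ⟨k, hk⟩ := exists_nat_ge γ
  have hA : 0 ≤ A := by simpa using ENNReal.toReal_nonneg.trans (hgrow 1 le_rfl)
  have hmeas : AEStronglyMeasurable (fun x : X => Real.exp (-dist x0 x)) m :=
    hcont.measurable.aestronglyMeasurable
  refine ⟨hmeas, ?_⟩
  rw [hasFiniteIntegral_iff_ofReal (Eventually.of_forall fun x => (Real.exp_pos _).le)]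
  have hpt : ∀ x : X, ENNReal.ofReal (Real.exp (-dist x0 x)) ≤
      ∑' n : ℕ, (ball x0 ((n : ℝ) + 1)).indicator
        (fun _ => ENNReal.ofReal (Real.exp (-(n : ℝ)))) x := by
    intro x
    refine le_trans ?_ (ENNReal.le_tsum ⌊dist x0 x⌋₊)
    rw [Set.indicator_of_mem]
    · gcongr
      exact Nat.floor_le dist_nonneg
    · rw [mem_ball, dist_comm]
      exact Nat.lt_floor_add_one _
  have hsum : Summable fun n : ℕ => Real.exp (-(n : ℝ)) * (A * ((n : ℝ) + 1) ^ k) := by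
    have h1 := (summable_nat_add_iff 1).mpr (Real.summable_pow_mul_exp_neg_nat_mul k one_pos)
    refine (h1.mul_left (A * Real.exp 1)).congr fun n => ?_
    have : Real.exp (-(n : ℝ)) = Real.exp 1 * Real.exp (-1 * ((n + 1 : ℕ) : ℝ)) := by
      rw [← Real.exp_add]; congr 1; push_cast; ring
    rw [this]; push_cast; ring
  calc ∫⁻ x, ENNReal.ofReal (Real.exp (-dist x0 x)) ∂m
      ≤ ∫⁻ x, ∑' n : ℕ, (ball x0 ((n : ℝ) + 1)).indicator
        (fun _ => ENNReal.ofReal (Real.exp (-(n : ℝ)))) x ∂m := lintegral_mono hpt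
    _ = ∑' n : ℕ, ENNReal.ofReal (Real.exp (-(n : ℝ))) * m (ball x0 ((n : ℝ) + 1)) := by
      rw [lintegral_tsum fun n => (measurable_const.indicator measurableSet_ball).aemeasurable]
      simp_rw [lintegral_indicator_const measurableSet_ball]
    _ ≤ ∑' n : ℕ, ENNReal.ofReal (Real.exp (-(n : ℝ)) * (A * ((n : ℝ) + 1) ^ k)) := by
      refine ENNReal.tsum_le_tsum fun n => ?_
      rw [ENNReal.ofReal_mul (Real.exp_pos _).le]
      gcongr
      rw [← ENNReal.ofReal_toReal (hfin _).ne]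
      gcongr
      have h1 : (1 : ℝ) ≤ (n : ℝ) + 1 := by simp
      refine (hgrow _ h1).trans ?_
      gcongr
      rw [← Real.rpow_natCast]
      exact Real.rpow_le_rpow_of_exponent_le h1 hk
    _ < ⊤ := by
      rw [← ENNReal.ofReal_tsum_of_nonneg (fun n => by positivity) hsum]
      exact ENNReal.ofReal_lt_top

/-- Gaussians centred at `x0` are integrable as soon as `exp (-dist x0 ·)` is. -/
theorem integrable_gaussian_dist {X : Type*} [MetricSpace X] [MeasurableSpace X] [BorelSpace X]
    {m : Measure X} {x0 : X} (h : Integrable (fun x => Real.exp (-dist x0 x)) m)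
    {l : ℝ} (hl : 0 < l) : Integrable (fun x => Real.exp (-l * dist x0 x ^ 2)) m := by
  have hcont : Continuous fun x : X => Real.exp (-l * dist x0 x ^ 2) := by fun_prop
  refine (h.const_mul (Real.exp (1 / (4 * l)))).mono' hcont.measurable.aestronglyMeasurable
    (Eventually.of_forall fun x => ?_)
  rw [Real.norm_of_nonneg (Real.exp_pos _).le, ← Real.exp_add]
  gcongr
  have : 1 / (4 * l) + -dist x0 x - -l * dist x0 x ^ 2 = l * (dist x0 x - 1 / (2 * l)) ^ 2 := by
    field_simp; ring
  nlinarith [mul_nonneg hl.le (sq_nonneg (dist x0 x - 1 / (2 * l)))]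

theorem sq_mul_exp_neg_le {l : ℝ} (hl : 0 < l) (t : ℝ) :
    t ^ 2 * Real.exp (-l * t ^ 2) ≤ 2 / l * Real.exp (-(l / 2) * t ^ 2) := by
  have h1 : l / 2 * t ^ 2 ≤ Real.exp (l / 2 * t ^ 2) := by
    linarith [Real.add_one_le_exp (l / 2 * t ^ 2)]
  have h2 : Real.exp (-(l / 2) * t ^ 2) = Real.exp (l / 2 * t ^ 2) * Real.exp (-l * t ^ 2) := by
    rw [← Real.exp_add]; congr 1; ring
  rw [h2, ← mul_assoc]
  gcongr
  rw [div_mul_eq_mul_div, le_div_iff₀ hl]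
  linarith

/-- Second moments of Gaussians centred at `x0` are finite. -/
theorem integrable_sq_mul_gaussian_dist {X : Type*} [MetricSpace X] [MeasurableSpace X]
    [BorelSpace X] {m : Measure X} {x0 : X} (h : Integrable (fun x => Real.exp (-dist x0 x)) m)
    {l : ℝ} (hl : 0 < l) :
    Integrable (fun x => dist x0 x ^ 2 * Real.exp (-l * dist x0 x ^ 2)) m := by
  have hcont : Continuous fun x : X => dist x0 x ^ 2 * Real.exp (-l * dist x0 x ^ 2) := by fun_prop
  refine ((integrable_gaussian_dist h (half_pos hl)).const_mul (2 / l)).mono'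
    hcont.measurable.aestronglyMeasurable (Eventually.of_forall fun x => ?_)
  rw [Real.norm_of_nonneg (by positivity)]
  exact sq_mul_exp_neg_le hl _

theorem hasDerivAt_integral_gaussian_dist {X : Type*} [MetricSpace X] [MeasurableSpace X]
    [BorelSpace X] {m : Measure X} {x0 : X} (h : Integrable (fun x => Real.exp (-dist x0 x)) m)
    {l : ℝ} (hl : 0 < l) :
    HasDerivAt (fun l => ∫ x, Real.exp (-l * dist x0 x ^ 2) ∂m)
      (-∫ x, dist x0 x ^ 2 * Real.exp (-l * dist x0 x ^ 2) ∂m) l := by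
  rw [← integral_neg]
  refine (hasDerivAt_integral_of_dominated_loc_of_deriv_le
    (F := fun l x => Real.exp (-l * dist x0 x ^ 2))
    (F' := fun l x => -(dist x0 x ^ 2 * Real.exp (-l * dist x0 x ^ 2)))
    (bound := fun x => dist x0 x ^ 2 * Real.exp (-(l / 2) * dist x0 x ^ 2))
    (Ioi_mem_nhds (half_lt_self hl)) ?_ (integrable_gaussian_dist h hl) ?_ ?_
    (integrable_sq_mul_gaussian_dist h (half_pos hl)) ?_).2
  · refine Eventually.of_forall fun l => ?_
    have hcont : Continuous fun x : X => Real.exp (-l * dist x0 x ^ 2) := by fun_prop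
    exact hcont.measurable.aestronglyMeasurable
  · exact (integrable_sq_mul_gaussian_dist h hl).neg.aestronglyMeasurable
  · refine Eventually.of_forall fun x t ht => ?_
    rw [norm_neg, Real.norm_of_nonneg (by positivity)]
    have : l / 2 ≤ t := (Set.mem_Ioi.mp ht).le
    gcongr
  · refine Eventually.of_forall fun x t _ => ?_
    have := ((hasDerivAt_neg t).mul_const (dist x0 x ^ 2)).exp
    simpa [mul_comm] using this

theorem lip_nonneg {X : Type*} [MetricSpace X] (u : X → ℝ) (x : X) : 0 ≤ lip u x := by
  rcases (𝓝[≠] x).eq_or_neBot with hx | hx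
  · simp [lip, hx, limsup, limsSup]
  · refine Real.sInf_nonneg fun a ha => ?_
    obtain ⟨y, hy⟩ := (show ∀ᶠ y in 𝓝[≠] x, |u y - u x| / dist y x ≤ a from ha).exists
    exact le_trans (by positivity) hy

theorem lip_le_of_eventually {X : Type*} [MetricSpace X] {u : X → ℝ} {x : X} {a : ℝ} (ha : 0 ≤ a)
    (h : ∀ᶠ y in 𝓝 x, |u y - u x| ≤ a * dist y x) : lip u x ≤ a := by
  rcases (𝓝[≠] x).eq_or_neBot with hx | hx
  · simp [lip, hx, limsup, limsSup, ha]
  · refine csInf_le ⟨0, fun b hb => ?_⟩ ?_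
    · obtain ⟨y, hy⟩ := (show ∀ᶠ y in 𝓝[≠] x, |u y - u x| / dist y x ≤ b from hb).exists
      exact le_trans (by positivity) hy
    · change ∀ᶠ y in 𝓝[≠] x, |u y - u x| / dist y x ≤ a
      filter_upwards [h.filter_mono nhdsWithin_le_nhds] with y hy
      exact div_le_of_le_mul₀ dist_nonneg ha hy

/-- The local Lipschitz constant of a truncated radial function is bounded by the derivative of
its profile. -/
theorem lip_max_sub_radial_le {X : Type*} [MetricSpace X] {g : ℝ → ℝ} {g' : ℝ} {x0 x : X}
    (hg : HasDerivAt g g' (dist x0 x)) (e : ℝ) :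
    lip (fun y => max (g (dist x0 y) - e) 0) x ≤ |g'| := by
  refine le_of_forall_gt_imp_ge_of_dense fun a ha => ?_
  have ha0 : 0 ≤ a := (abs_nonneg _).trans ha.le
  refine lip_le_of_eventually ha0 ?_
  have h1 := hg.hasDerivWithinAt (s := Set.univ).limsup_norm_slope_le ha
  rw [nhdsWithin_univ] at h1
  have h2 : Tendsto (fun y => dist x0 y) (𝓝 x) (𝓝 (dist x0 x)) :=
    (continuous_const.dist continuous_id).tendsto x
  filter_upwards [h2.eventually h1] with y hy
  have h3 : |dist x0 y - dist x0 x| ≤ dist y x := by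
    rw [dist_comm x0 y, dist_comm x0 x]; exact abs_dist_sub_le y x x0
  have h4 : |g (dist x0 y) - g (dist x0 x)| ≤ a * |dist x0 y - dist x0 x| := by
    rcases eq_or_ne (dist x0 y) (dist x0 x) with he | he
    · simp [he]
    · have hp : 0 < |dist x0 y - dist x0 x| := abs_pos.mpr (sub_ne_zero.mpr he)
      rw [Real.norm_eq_abs, Real.norm_eq_abs, inv_mul_lt_iff₀ hp] at hy
      linarith
  calc |max (g (dist x0 y) - e) 0 - max (g (dist x0 x) - e) 0|
      ≤ |(g (dist x0 y) - e) - (g (dist x0 x) - e)| := abs_max_sub_max_le_abs _ _ _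
    _ = |g (dist x0 y) - g (dist x0 x)| := by congr 1; ring
    _ ≤ a * |dist x0 y - dist x0 x| := h4
    _ ≤ a * dist y x := by gcongr

theorem hasDerivAt_gaussian_half (l t : ℝ) :
    HasDerivAt (fun t => Real.exp (-(l / 2) * t ^ 2))
      (-(l * t * Real.exp (-(l / 2) * t ^ 2))) t := by
  have := ((hasDerivAt_pow 2 t).const_mul (-(l / 2))).exp
  convert this using 1
  push_cast
  ring

theorem lipschitzWith_gaussian_half {l : ℝ} (hl : 0 < l) :
    LipschitzWith (l / 2 + 1).toNNReal (fun t : ℝ => Real.exp (-(l / 2) * t ^ 2)) := by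
  refine lipschitzWith_of_nnnorm_deriv_le
    (fun t => (hasDerivAt_gaussian_half l t).differentiableAt) fun t => ?_
  rw [(hasDerivAt_gaussian_half l t).deriv, ← NNReal.coe_le_coe, coe_nnnorm,
    Real.coe_toNNReal _ (by positivity), norm_neg, norm_mul, norm_mul,
    Real.norm_of_nonneg hl.le, Real.norm_of_nonneg (Real.exp_pos _).le, Real.norm_eq_abs]
  have h1 : l / 2 * t ^ 2 + 1 ≤ Real.exp (l / 2 * t ^ 2) := Real.add_one_le_exp _
  have h2 : Real.exp (-(l / 2) * t ^ 2) = (Real.exp (l / 2 * t ^ 2))⁻¹ := by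
    rw [← Real.exp_neg]; congr 1; ring
  rw [h2, ← div_eq_mul_inv, div_le_iff₀ (Real.exp_pos _)]
  have h3 : |t| ≤ (1 + t ^ 2) / 2 := by nlinarith [sq_nonneg (|t| - 1), sq_abs t]
  have h4 : 0 ≤ l / 2 * t ^ 2 := by positivity
  nlinarith [mul_le_mul_of_nonneg_left h3 hl.le, mul_pos hl hl]

/-- The Gaussian, truncated at height `e` so as to have bounded support. -/
noncomputable def truncGaussian {X : Type*} [MetricSpace X] (x0 : X) (l e : ℝ) (x : X) : ℝ :=
  max (Real.exp (-(l / 2) * dist x0 x ^ 2) - e) 0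

theorem lipschitzWith_truncGaussian {X : Type*} [MetricSpace X] (x0 : X) {l : ℝ} (hl : 0 < l)
    (e : ℝ) : ∃ K : ℝ≥0, LipschitzWith K (truncGaussian x0 l e) := by
  have h1 := (lipschitzWith_gaussian_half hl).comp (LipschitzWith.dist_right x0)
  exact ⟨_, (h1.sub (LipschitzWith.const e)).max_const 0⟩

theorem isBounded_support_truncGaussian {X : Type*} [MetricSpace X] (x0 : X) {l e : ℝ}
    (hl : 0 < l) (he : 0 < e) :
    Bornology.IsBounded (Function.support (truncGaussian x0 l e)) := by
  refine (isBounded_closedBall (x := x0) (r := 1 + 2 / (l * e))).subset fun x hx => ?_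
  have hx1 : e < Real.exp (-(l / 2) * dist x0 x ^ 2) := by
    by_contra hcon
    exact hx (max_eq_right (by linarith))
  have h1 : l / 2 * dist x0 x ^ 2 + 1 ≤ Real.exp (l / 2 * dist x0 x ^ 2) := Real.add_one_le_exp _
  have h2 : Real.exp (-(l / 2) * dist x0 x ^ 2) * Real.exp (l / 2 * dist x0 x ^ 2) = 1 := by
    rw [← Real.exp_add]; simp
  have h3 : e * (l / 2 * dist x0 x ^ 2) ≤ 1 := by
    nlinarith [Real.exp_pos (l / 2 * dist x0 x ^ 2)]
  have h4 : dist x0 x ^ 2 ≤ 2 / (l * e) := by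
    rw [le_div_iff₀ (by positivity)]; linarith
  rw [mem_closedBall, dist_comm]
  nlinarith [sq_nonneg (dist x0 x - 1)]

theorem truncGaussian_nonneg {X : Type*} [MetricSpace X] (x0 : X) (l e : ℝ) (x : X) :
    0 ≤ truncGaussian x0 l e x := le_max_right _ _

theorem sq_exp_neg_half_mul (l t : ℝ) :
    Real.exp (-(l / 2) * t) ^ 2 = Real.exp (-l * t) := by
  rw [← Real.exp_nat_mul]; congr 1; push_cast; ring

theorem truncGaussian_sq_le {X : Type*} [MetricSpace X] (x0 : X) (l : ℝ) {e : ℝ} (he : 0 ≤ e)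
    (x : X) : truncGaussian x0 l e x ^ 2 ≤ Real.exp (-l * dist x0 x ^ 2) := by
  rw [← sq_exp_neg_half_mul]
  refine pow_le_pow_left₀ (truncGaussian_nonneg ..) (max_le ?_ (Real.exp_pos _).le) 2
  linarith

theorem lip_truncGaussian_sq_le {X : Type*} [MetricSpace X] (x0 : X) (l e : ℝ) (x : X) :
    lip (truncGaussian x0 l e) x ^ 2 ≤
      l ^ 2 * (dist x0 x ^ 2 * Real.exp (-l * dist x0 x ^ 2)) := by
  have h := lip_max_sub_radial_le (hasDerivAt_gaussian_half l (dist x0 x)) e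
  refine (pow_le_pow_left₀ (lip_nonneg _ x) h 2).trans_eq ?_
  rw [sq_abs, neg_sq, mul_pow, mul_pow, sq_exp_neg_half_mul, mul_assoc]

theorem tendsto_integral_truncGaussian_sq {X : Type*} [MetricSpace X] [MeasurableSpace X]
    [BorelSpace X] {m : Measure X} {x0 : X} (h : Integrable (fun x => Real.exp (-dist x0 x)) m)
    {l : ℝ} (hl : 0 < l) :
    Tendsto (fun n : ℕ => ∫ x, truncGaussian x0 l (1 / ((n : ℝ) + 1)) x ^ 2 ∂m) atTop
      (𝓝 (∫ x, Real.exp (-l * dist x0 x ^ 2) ∂m)) := by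
  refine tendsto_integral_of_dominated_convergence _ (fun n => ?_)
    (integrable_gaussian_dist h hl) (fun n => Eventually.of_forall fun x => ?_)
    (Eventually.of_forall fun x => ?_)
  · obtain ⟨K, hK⟩ := lipschitzWith_truncGaussian x0 hl (1 / ((n : ℝ) + 1))
    exact (hK.continuous.pow 2).measurable.aestronglyMeasurable
  · rw [Real.norm_of_nonneg (sq_nonneg _)]
    exact truncGaussian_sq_le x0 l (by positivity) x
  · rw [← sq_exp_neg_half_mul]
    have h1 := ((tendsto_one_div_add_atTop_nhds_zero_nat (𝕜 := ℝ)).const_sub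
      (Real.exp (-(l / 2) * dist x0 x ^ 2))).max (tendsto_const_nhds (x := (0 : ℝ)))
    rw [sub_zero, max_eq_left (Real.exp_pos _).le] at h1
    exact h1.pow 2

/-- The Heisenberg-type inequality, tested on Gaussians. -/
theorem mul_integral_gaussian_le {X : Type*} [MetricSpace X] [MeasurableSpace X]
    [BorelSpace X] {m : Measure X} {x0 : X} (h : Integrable (fun x => Real.exp (-dist x0 x)) m)
    {C : ℝ}
    (hCKN : ∀ u : X → ℝ, (∃ K : ℝ≥0, LipschitzWith K u) →
      Bornology.IsBounded (Function.support u) →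
      C ^ 2 * (∫ x, u x ^ 2 ∂m) ^ 2 ≤
        (∫ x, lip u x ^ 2 ∂m) * (∫ x, dist x0 x ^ 2 * u x ^ 2 ∂m))
    {l : ℝ} (hl : 0 < l) :
    C * ∫ x, Real.exp (-l * dist x0 x ^ 2) ∂m ≤
      l * ∫ x, dist x0 x ^ 2 * Real.exp (-l * dist x0 x ^ 2) ∂m := by
  refine le_of_tendsto ((tendsto_integral_truncGaussian_sq h hl).const_mul C)
    (Eventually.of_forall fun n => ?_)
  have he : 0 < 1 / ((n : ℝ) + 1) := by positivity
  set u := truncGaussian x0 l (1 / ((n : ℝ) + 1)) with hu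
  have hH := integrable_sq_mul_gaussian_dist h hl
  set H := ∫ x, dist x0 x ^ 2 * Real.exp (-l * dist x0 x ^ 2) ∂m with hHdef
  have hH0 : 0 ≤ H := integral_nonneg fun x => by positivity
  have h1 : ∫ x, lip u x ^ 2 ∂m ≤ l ^ 2 * H := by
    rw [hHdef, ← integral_const_mul]
    exact integral_mono_of_nonneg (Eventually.of_forall fun x => sq_nonneg _) (hH.const_mul _)
      (Eventually.of_forall fun x => lip_truncGaussian_sq_le x0 l _ x)
  have h2 : ∫ x, dist x0 x ^ 2 * u x ^ 2 ∂m ≤ H :=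
    integral_mono_of_nonneg (Eventually.of_forall fun x => by positivity) hH
      (Eventually.of_forall fun x => mul_le_mul_of_nonneg_left
        (truncGaussian_sq_le x0 l he.le x) (sq_nonneg _))
  have h3 := hCKN u (lipschitzWith_truncGaussian x0 hl _)
    (isBounded_support_truncGaussian x0 hl he)
  refine le_of_sq_le_sq ?_ (by positivity)
  calc (C * ∫ x, u x ^ 2 ∂m) ^ 2 = C ^ 2 * (∫ x, u x ^ 2 ∂m) ^ 2 := mul_pow _ _ _
    _ ≤ (l ^ 2 * H) * H := h3.trans (mul_le_mul h1 h2
        (integral_nonneg fun x => by positivity) (by positivity))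
    _ = (l * H) ^ 2 := by ring

theorem antitoneOn_rpow_mul_of_hasDerivAt {G H : ℝ → ℝ} {C : ℝ}
    (hG : ∀ l, 0 < l → HasDerivAt G (-H l) l) (hGH : ∀ l, 0 < l → C * G l ≤ l * H l) :
    AntitoneOn (fun l => l ^ C * G l) (Set.Ioi 0) := by
  have hder : ∀ l, 0 < l → HasDerivAt (fun l => l ^ C * G l)
      (C * l ^ (C - 1) * G l + l ^ C * -H l) l := fun l hl =>
    (Real.hasDerivAt_rpow_const (Or.inl hl.ne')).mul (hG l hl)
  refine antitoneOn_of_deriv_nonpos (convex_Ioi 0)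
    (fun l hl => (hder l hl).continuousAt.continuousWithinAt)
    (fun l hl => ?_) (fun l hl => ?_)
  · rw [interior_Ioi] at hl
    exact (hder l hl).differentiableAt.differentiableWithinAt
  · rw [interior_Ioi, Set.mem_Ioi] at hl
    rw [(hder l hl).deriv]
    have h1 : l ^ C = l ^ (C - 1) * l := by
      rw [← Real.rpow_add_one hl.ne', sub_add_cancel]
    rw [h1]
    have h2 := mul_le_mul_of_nonneg_left (hGH l hl) (Real.rpow_pos_of_pos hl (C - 1)).le
    linarith

/-- A Gaussian of width `r` has integral at least `exp (-1)` times the volume of `ball x0 r`. -/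
theorem exp_neg_one_mul_le_integral_gaussian {X : Type*} [MetricSpace X] [MeasurableSpace X]
    [BorelSpace X] {m : Measure X} {x0 : X} (h : Integrable (fun x => Real.exp (-dist x0 x)) m)
    {r : ℝ} (hr : 0 < r) :
    Real.exp (-1) * (m (ball x0 r)).toReal ≤
      ∫ x, Real.exp (-(r ^ 2)⁻¹ * dist x0 x ^ 2) ∂m := by
  have hint := integrable_gaussian_dist h (l := (r ^ 2)⁻¹) (by positivity)
  have h1 : ∫ x, (ball x0 r).indicator (fun _ => Real.exp (-1)) x ∂m =
      Real.exp (-1) * (m (ball x0 r)).toReal := by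
    rw [integral_indicator_const _ measurableSet_ball, smul_eq_mul, mul_comm, Measure.real]
  rw [← h1]
  refine integral_mono_of_nonneg
    (Eventually.of_forall fun x => Set.indicator_nonneg (fun _ _ => (Real.exp_pos _).le) x) hint
    (Eventually.of_forall fun x => ?_)
  refine Set.indicator_le' (g := fun y => Real.exp (-(r ^ 2)⁻¹ * dist x0 y ^ 2))
    (fun y hy => ?_) (fun y _ => (Real.exp_pos _).le) x
  rw [mem_ball, dist_comm] at hy
  have h2 : dist x0 y ^ 2 ≤ r ^ 2 := by gcongr
  have h3 : (r ^ 2)⁻¹ * dist x0 y ^ 2 ≤ 1 := by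
    rw [inv_mul_le_iff₀ (by positivity), mul_one]; exact h2
  apply Real.exp_le_exp.mpr
  linarith

theorem Real.liminf_eq_zero_of_tendsto_atTop {α : Type*} {l : Filter α} {f : α → ℝ}
    (h : Tendsto f l atTop) : liminf f l = 0 := by
  have : {a : ℝ | ∀ᶠ x in l, a ≤ f x} = Set.univ :=
    Set.eq_univ_of_forall fun a => h.eventually_ge_atTop a
  rw [liminf_eq, this, Real.sSup_univ]

theorem stmt_2 {X : Type*} [MetricSpace X] [CompleteSpace X]
    [TopologicalSpace.SeparableSpace X] [MeasurableSpace X] [BorelSpace X]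
    (m : Measure X)
    (hm : ∀ U : Set X, IsOpen U → U.Nonempty → Bornology.IsBounded U → 0 < m U ∧ m U < ⊤)
    (x0 : X) (β γ D : ℝ) (hβ : 0 < β) (hγ : 0 < γ) (hD : 1 ≤ D)
    (C : ℝ) (hC : 0 < C)
    (hCKN : ∀ (k : ℕ) (u : X → ℝ), (∃ K : ℝ≥0, LipschitzWith K u) →
      Bornology.IsBounded (Function.support u) →
      (∫ x, dist x0 x ^ (2 * k) * (lip u x) ^ 2 ∂m) *
        (∫ x, dist x0 x ^ (2 * k + 2) * (u x) ^ 2 ∂m) ≥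
      (C + k) ^ 2 * (∫ x, dist x0 x ^ (2 * k) * (u x) ^ 2 ∂m) ^ 2)
    (hVD : ∀ (x : X) (r R : ℝ), 0 < r → r < R →
      (m (ball x R)).toReal / R ^ γ ≤ D * ((m (ball x r)).toReal / r ^ γ))
    (cstar : ℝ) (hcstar : 0 < cstar)
    (hAR : Filter.liminf (fun r : ℝ => (m (ball x0 r)).toReal / r ^ β) (𝓝[>] 0) = cstar) :
    2 * C ≤ β ∧ β ≤ γ := by
  have hball : ∀ r, m (ball x0 r) < ⊤ := fun r => by
    rcases (ball x0 r).eq_empty_or_nonempty with he | hne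
    · simp [he]
    · exact (hm _ isOpen_ball hne isBounded_ball).2
  have hb1 : 0 < (m (ball x0 1)).toReal :=
    ENNReal.toReal_pos (hm _ isOpen_ball ⟨x0, mem_ball_self one_pos⟩ isBounded_ball).1.ne'
      (hball 1).ne
  have hD0 : 0 < D := by linarith
  have hev : ∀ᶠ r : ℝ in 𝓝[>] 0, cstar / 2 < (m (ball x0 r)).toReal / r ^ β := by
    refine eventually_lt_of_lt_liminf (by rw [hAR]; linarith) ⟨0, ?_⟩
    rw [eventually_map]
    filter_upwards [self_mem_nhdsWithin] with r hr
    have : 0 < r := hr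
    change (m (ball x0 r)).toReal / r ^ β ≥ 0
    positivity
  constructor
  · have hgrow : ∀ R : ℝ, 1 ≤ R →
        (m (ball x0 R)).toReal ≤ D * (m (ball x0 1)).toReal * R ^ γ := by
      intro R hR
      rcases hR.eq_or_lt with rfl | hR
      · rw [Real.one_rpow]
        nlinarith
      · have h := hVD x0 1 R one_pos hR
        rwa [Real.one_rpow, div_one, div_le_iff₀ (by positivity)] at h
    have hexp := integrable_exp_neg_dist m x0 _ γ hball hgrow
    set G : ℝ → ℝ := fun l => ∫ x, Real.exp (-l * dist x0 x ^ 2) ∂m with hG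
    have hanti : AntitoneOn (fun l => l ^ C * G l) (Set.Ioi 0) :=
      antitoneOn_rpow_mul_of_hasDerivAt
        (fun l hl => hasDerivAt_integral_gaussian_dist hexp hl)
        (fun l hl => mul_integral_gaussian_le hexp
          (fun u hu hs => by simpa using hCKN 0 u hu hs) hl)
    by_contra! hcon
    have hdiv : Tendsto (fun r : ℝ => Real.exp (-1) * (cstar / 2) * r ^ (β - 2 * C))
        (𝓝[>] 0) atTop :=
      (tendsto_rpow_neg_nhdsGT_zero (by linarith)).const_mul_atTop (by positivity)
    have hlt : ∀ᶠ r : ℝ in 𝓝[>] 0, r < 1 :=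
      (eventually_lt_nhds one_pos).filter_mono nhdsWithin_le_nhds
    obtain ⟨r, hr1, hrc, hrdiv, hr0⟩ := (hlt.and (hev.and
      ((hdiv.eventually_gt_atTop ((1 : ℝ) ^ C * G 1)).and self_mem_nhdsWithin))).exists
    have hr : 0 < r := hr0
    have h1 : (1 : ℝ) ≤ (r ^ 2)⁻¹ := (one_le_inv₀ (by positivity)).mpr (by nlinarith)
    have h2 := hanti (Set.mem_Ioi.mpr one_pos) (Set.mem_Ioi.mpr (one_pos.trans_le h1)) h1
    have h3 : Real.exp (-1) * (m (ball x0 r)).toReal ≤ G (r ^ 2)⁻¹ :=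
      exp_neg_one_mul_le_integral_gaussian hexp hr
    rw [lt_div_iff₀ (by positivity)] at hrc
    have h4 : ((r ^ 2)⁻¹ : ℝ) ^ C = r ^ (-(2 * C)) := by
      rw [Real.rpow_neg hr.le, Real.inv_rpow (by positivity), Real.rpow_mul hr.le,
        Real.rpow_two]
    have h5 : r ^ (β - 2 * C) = r ^ (-(2 * C)) * r ^ β := by
      rw [← Real.rpow_add hr]; congr 1; ring
    have h6 : Real.exp (-1) * (cstar / 2 * r ^ β) ≤ G (r ^ 2)⁻¹ :=
      (mul_le_mul_of_nonneg_left hrc.le (Real.exp_pos _).le).trans h3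
    have h7 := mul_le_mul_of_nonneg_left h6 (Real.rpow_pos_of_pos hr (-(2 * C))).le
    simp only [h4] at h2
    rw [h5] at hrdiv
    linarith
  · by_contra! hcon
    refine hcstar.ne' (hAR.symm.trans (Real.liminf_eq_zero_of_tendsto_atTop ?_))
    have hdiv : Tendsto (fun r : ℝ => (m (ball x0 1)).toReal / D * r ^ (γ - β))
        (𝓝[>] 0) atTop :=
      (tendsto_rpow_neg_nhdsGT_zero (by linarith)).const_mul_atTop (by positivity)
    refine tendsto_atTop_mono' _ ?_ hdiv
    filter_upwards [self_mem_nhdsWithin,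
      (eventually_lt_nhds one_pos).filter_mono nhdsWithin_le_nhds] with r hr0 hr1
    have hr : 0 < r := hr0
    have h := hVD x0 r 1 hr hr1
    rw [Real.one_rpow, div_one, ← mul_div_assoc, le_div_iff₀ (by positivity)] at h
    rw [Real.rpow_sub hr, ← mul_div_assoc]
    gcongr
    rw [div_mul_eq_mul_div, div_le_iff₀ hD0]
    linarith
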